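/- Let M, N, K be positive integers and A ∈ ℝ^{M×N}. Then for all U, H₁ ∈ ℝ^{M×K} and Z, H₂ ∈ ℝ^{K×N}: ‖H₁Z + UH₂‖_F² − 2⟨A − UZ, H₁H₂⟩_F ≤ (3‖Z‖_F² + ‖A‖_F)‖H₁‖_F² + (3‖U‖_F² + ‖A‖_F)‖H₂‖_F². -/

import Mathlib

/-- Frobenius inner product of real matrices. -/
noncomputable def fip {m n : ℕ} (X Y : Matrix (Fin m) (Fin n) ℝ) : ℝ :=
  ∑ i, ∑ j, X i j * Y i j

/-- Frobenius norm of a real matrix. -/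
noncomputable def fnorm {m n : ℕ} (X : Matrix (Fin m) (Fin n) ℝ) : ℝ :=
  Real.sqrt (fip X X)

theorem fip_self_nonneg {m n : ℕ} (X : Matrix (Fin m) (Fin n) ℝ) : 0 ≤ fip X X :=
  Finset.sum_nonneg fun _ _ => Finset.sum_nonneg fun _ _ => mul_self_nonneg _

theorem fnorm_nonneg {m n : ℕ} (X : Matrix (Fin m) (Fin n) ℝ) : 0 ≤ fnorm X :=
  Real.sqrt_nonneg _

theorem fnorm_sq {m n : ℕ} (X : Matrix (Fin m) (Fin n) ℝ) : fnorm X ^ 2 = fip X X :=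
  Real.sq_sqrt (fip_self_nonneg X)

theorem fip_sub_left {m n : ℕ} (X Y W : Matrix (Fin m) (Fin n) ℝ) :
    fip (X - Y) W = fip X W - fip Y W := by
  simp only [fip, Matrix.sub_apply, sub_mul, Finset.sum_sub_distrib]

theorem fip_add_self {m n : ℕ} (X Y : Matrix (Fin m) (Fin n) ℝ) :
    fip (X + Y) (X + Y) = fip X X + 2 * fip X Y + fip Y Y := by
  simp only [fip, Matrix.add_apply, Finset.mul_sum, ← Finset.sum_add_distrib]
  refine Finset.sum_congr rfl fun i _ => Finset.sum_congr rfl fun j _ => ?_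
  ring

/-- Cauchy–Schwarz inequality for the Frobenius inner product. -/
theorem abs_fip_le {m n : ℕ} (X Y : Matrix (Fin m) (Fin n) ℝ) :
    |fip X Y| ≤ fnorm X * fnorm Y := by
  refine abs_le_of_sq_le_sq ?_ (mul_nonneg (fnorm_nonneg X) (fnorm_nonneg Y))
  rw [mul_pow, fnorm_sq, fnorm_sq]
  simp only [fip, ← Fintype.sum_prod_type', ← pow_two]
  exact Finset.sum_mul_sq_le_sq_mul_sq _ _ _

/-- The Frobenius norm is submultiplicative. -/
theorem fnorm_mul_le {m k n : ℕ} (X : Matrix (Fin m) (Fin k) ℝ) (Y : Matrix (Fin k) (Fin n) ℝ) :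
    fnorm (X * Y) ≤ fnorm X * fnorm Y := by
  refine le_of_sq_le_sq ?_ (mul_nonneg (fnorm_nonneg X) (fnorm_nonneg Y))
  rw [mul_pow, fnorm_sq, fnorm_sq, fnorm_sq]
  simp only [fip, ← pow_two]
  rw [Finset.sum_comm (f := fun i j => Y i j ^ 2), Finset.sum_mul_sum]
  refine Finset.sum_le_sum fun i _ => Finset.sum_le_sum fun j _ => ?_
  rw [Matrix.mul_apply]
  exact Finset.sum_mul_sq_le_sq_mul_sq _ _ _

/-- the second-order quadratic form of g(U,Z) = ½‖A − UZ‖_F² is bounded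
by (3‖Z‖² + ‖A‖)‖H₁‖² + (3‖U‖² + ‖A‖)‖H₂‖². -/
theorem stmt1 (M N K : ℕ) (hM : 0 < M) (hN : 0 < N) (hK : 0 < K)
    (A : Matrix (Fin M) (Fin N) ℝ)
    (U H₁ : Matrix (Fin M) (Fin K) ℝ) (Z H₂ : Matrix (Fin K) (Fin N) ℝ) :
    fnorm (H₁ * Z + U * H₂) ^ 2 - 2 * fip (A - U * Z) (H₁ * H₂) ≤
      (3 * fnorm Z ^ 2 + fnorm A) * fnorm H₁ ^ 2 +
      (3 * fnorm U ^ 2 + fnorm A) * fnorm H₂ ^ 2 := by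
  have hz := fnorm_nonneg Z
  have hu := fnorm_nonneg U
  have ha := fnorm_nonneg A
  have h1 := fnorm_nonneg H₁
  have h2 := fnorm_nonneg H₂
  have hHZ := fnorm_mul_le H₁ Z
  have hUH := fnorm_mul_le U H₂
  have hUZ := fnorm_mul_le U Z
  have hHH := fnorm_mul_le H₁ H₂
  have sqHZ := pow_le_pow_left₀ (fnorm_nonneg _) hHZ 2
  have sqUH := pow_le_pow_left₀ (fnorm_nonneg _) hUH 2
  have cross := (le_abs_self _).trans <| (abs_fip_le (H₁ * Z) (U * H₂)).trans <|
    mul_le_mul hHZ hUH (fnorm_nonneg _) (mul_nonneg h1 hz)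
  have quad := (le_abs_self _).trans <| (abs_fip_le (U * Z) (H₁ * H₂)).trans <|
    mul_le_mul hUZ hHH (fnorm_nonneg _) (mul_nonneg hu hz)
  have lin := (neg_le_abs _).trans <| (abs_fip_le A (H₁ * H₂)).trans <|
    mul_le_mul_of_nonneg_left hHH ha
  rw [fnorm_sq (H₁ * Z + U * H₂), fip_add_self, fip_sub_left, ← fnorm_sq, ← fnorm_sq]
  have amgm := mul_nonneg ha (sq_nonneg (fnorm H₁ - fnorm H₂))
  have amgm' := sq_nonneg (fnorm H₁ * fnorm Z - fnorm U * fnorm H₂)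
  linarith only [sqHZ, sqUH, cross, quad, lin, amgm, amgm']
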